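/- Under the protocol, suppose G(t) is B-core-connected, (i,j) is a core edge, and t is a multiple of B satisfying t ≥ 2^{2/(1−α)} ⌈32B + 8B·W(0)⌉^{1/(β−α)} + (32B·‖x(0)‖_∞)^{2/(1−α)}. Then there exists a time t' ∈ [t+1, t+3B] with (i,j) ∈ E(t') and q_{i→j}(t') = q_{j→i}(t') = 0. Here W(0) = max_k x_k(0) − min_k x_k(0) and ‖x(0)‖_∞ = max_k |x_k(0)|. -/

import Mathlib

open scoped Classical

noncomputable section

/-- The rounding function `R` sending `x` to `1`, `0`, `-1` according to `x > 1`,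
`-1 ≤ x ≤ 1`, `x < -1`. -/
def Rq (y : ℝ) : ℝ := if y > 1 then 1 else if y < -1 then -1 else 0

/-- The data and evolution equations of the ternary-message average-consensus protocol
on `n` nodes.  `E t i j` means the edge `(i,j)` is present in the graph `G(t)`
(for `t ≥ 1`); `x t i` is the value of node `i` at time `t`; `xin t i j` is
`x̂_{i,j,in}(t)`, `xout t i j` is `x̂_{i,j,out}(t)` and `q t i j` is `q_{i→j}(t)`. -/
structure Protocol (n : ℕ) where
  α : ℝ
  β : ℝ
  hα : 0 < α
  hαβ : α < β
  hβ : β < 1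
  E : ℕ → Fin n → Fin n → Prop
  Esymm : ∀ t i j, E t i j → E t j i
  Eirrefl : ∀ t i, ¬ E t i i
  D : Fin n → Fin n → ℕ → ℝ
  Dsymm : ∀ i j t, D i j t = D j i t
  Dbound : ∀ t i j, E t i j →
    ((max (Set.ncard {k | E t i k}) (Set.ncard {k | E t j k}) : ℕ) : ℝ) ≤ D i j t
  x : ℕ → Fin n → ℝ
  xin : ℕ → Fin n → Fin n → ℝ
  xout : ℕ → Fin n → Fin n → ℝ
  q : ℕ → Fin n → Fin n → ℝ
  hxin0 : ∀ i j, xin 0 i j = 0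
  hxout0 : ∀ i j, xout 0 i j = 0
  hq : ∀ t, 1 ≤ t → ∀ i j, E t i j →
    q t i j = Rq ((t : ℝ) ^ α * (x (t - 1) i - xout (t - 1) i j))
  hxoutE : ∀ t, 1 ≤ t → ∀ i j, E t i j →
    xout t i j = xout (t - 1) i j + q t i j / (t : ℝ) ^ α
  hxinE : ∀ t, 1 ≤ t → ∀ i j, E t i j →
    xin t i j = xin (t - 1) i j + q t j i / (t : ℝ) ^ α
  hxoutN : ∀ t, 1 ≤ t → ∀ i j, ¬ E t i j → xout t i j = xout (t - 1) i j
  hxinN : ∀ t, 1 ≤ t → ∀ i j, ¬ E t i j → xin t i j = xin (t - 1) i j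
  hx : ∀ t, 1 ≤ t → ∀ i, x t i = x (t - 1) i + (1 / (t : ℝ) ^ β) *
    ∑ j ∈ Finset.univ.filter (fun j => E t i j ∧
        4 / (t : ℝ) ^ α < |xin t i j - xout t i j| ∧ q t j i = 0 ∧ q t i j = 0),
      (xin t i j - xout t i j) / (4 * D i j t)

namespace Protocol

variable {n : ℕ} (P : Protocol n)

/-- The set `S(i,t)` of neighbors that node `i` includes in its update at time `t`. -/
def S (t : ℕ) (i : Fin n) : Finset (Fin n) :=
  Finset.univ.filter (fun j => P.E t i j ∧
    4 / (t : ℝ) ^ P.α < |P.xin t i j - P.xout t i j| ∧ P.q t j i = 0 ∧ P.q t i j = 0)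

/-- The graph sequence of the protocol is `B`-core-connected with core edge
relation `Einf`: every core edge appears at some time, the graph of core edges is
connected, and every core edge appears in every time window `[kB+1, (k+1)B]`. -/
def CoreConnected (B : ℕ) (Einf : Fin n → Fin n → Prop) : Prop :=
  (∀ i j, Einf i j → ∃ t, 1 ≤ t ∧ P.E t i j) ∧
  (SimpleGraph.fromRel Einf).Connected ∧
  ∀ k : ℕ, ∀ i j, Einf i j → ∃ t, k * B + 1 ≤ t ∧ t ≤ (k + 1) * B ∧ P.E t i j

end Protocol

/-- `M(x)`: the largest coordinate. -/
def maxV {n : ℕ} (y : Fin n → ℝ) : ℝ := ⨆ i, y i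

/-- `m(x)`: the smallest coordinate. -/
def minV {n : ℕ} (y : Fin n → ℝ) : ℝ := ⨅ i, y i

/-- `W(x) = M(x) - m(x)`. -/
def Wsp {n : ℕ} (y : Fin n → ℝ) : ℝ := maxV y - minV y

/-- The sup norm `‖x‖_∞ = max_i |x_i|`. -/
def normInf {n : ℕ} (y : Fin n → ℝ) : ℝ := ⨆ i, |y i|

/-- `V2(x) = sqrt(Σ_i (x_i - (1/n) Σ_j x_j)²)`. -/
def V2 {n : ℕ} (y : Fin n → ℝ) : ℝ :=
  Real.sqrt (∑ i, (y i - (∑ j, y j) / n) ^ 2)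

lemma Rq_eq_zero_iff {y : ℝ} : Rq y = 0 ↔ |y| ≤ 1 := by
  unfold Rq
  rw [abs_le]
  split_ifs with h₁ h₂
  · simp only [one_ne_zero, false_iff]; intro h; linarith [h.2]
  · simp only [neg_eq_zero, one_ne_zero, false_iff]; intro h; linarith [h.1]
  · simp only [true_iff]; constructor <;> linarith

/-- A quantized correction with step `1 / c` never overshoots. -/
lemma abs_sub_Rq_div {c e : ℝ} (hc : 0 < c) (h : 1 / c < |e|) :
    |e - Rq (c * e) / c| = |e| - 1 / c := by
  have h' : 1 < c * |e| := by rwa [div_lt_iff₀' hc] at h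
  have hc' : 0 < 1 / c := by positivity
  unfold Rq
  rcases abs_cases e with ⟨he, hs⟩ | ⟨he, hs⟩
  · rw [he] at h h' ⊢
    rw [if_pos h', abs_of_pos (by linarith)]
  · rw [he] at h h' ⊢
    rw [if_neg (by linarith), if_pos (by linarith), neg_div, abs_of_neg (by linarith)]
    ring

lemma Rq_mul_eq_zero_iff {c e : ℝ} (hc : 0 < c) : Rq (c * e) = 0 ↔ |e| ≤ 1 / c := by
  rw [Rq_eq_zero_iff, abs_mul, abs_of_pos hc, le_div_iff₀' hc]

lemma one_div_rpow_anti {a : ℝ} (ha : 0 ≤ a) {s u : ℝ} (hs : 0 < s) (hsu : s ≤ u) :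
    1 / u ^ a ≤ 1 / s ^ a :=
  one_div_le_one_div_of_le (Real.rpow_pos_of_pos hs a) (Real.rpow_le_rpow hs.le hsu ha)

lemma mul_one_div_rpow_mono {a : ℝ} (ha : a ≤ 1) {s u : ℝ} (hs : 0 < s) (hsu : s ≤ u) :
    s * (1 / s ^ a) ≤ u * (1 / u ^ a) := by
  have key : ∀ r : ℝ, 0 < r → r * (1 / r ^ a) = r ^ (1 - a) := fun r hr => by
    rw [Real.rpow_sub hr, Real.rpow_one, mul_one_div]
  rw [key s hs, key u (hs.trans_le hsu)]
  exact Real.rpow_le_rpow hs.le hsu (by linarith)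

namespace Protocol

variable {n : ℕ} (P : Protocol n)

lemma xin_eq_xout (s : ℕ) (i j : Fin n) : P.xin s i j = P.xout s j i := by
  induction s with
  | zero => rw [P.hxin0, P.hxout0]
  | succ s ih =>
    by_cases h : P.E (s + 1) i j
    · rw [P.hxinE _ (by omega) i j h, P.hxoutE _ (by omega) j i (P.Esymm _ _ _ h)]
      simpa using ih
    · rw [P.hxinN _ (by omega) i j h,
        P.hxoutN _ (by omega) j i (fun h' => h (P.Esymm _ _ _ h'))]
      simpa using ih

/-- The error of the estimate of `x_i` held across the edge `(i,j)`. -/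
def err (s : ℕ) (i j : Fin n) : ℝ := P.x s i - P.xout s i j

lemma succ_rpow_pos (s : ℕ) (a : ℝ) : (0 : ℝ) < ((s + 1 : ℕ) : ℝ) ^ a :=
  Real.rpow_pos_of_pos (by positivity) a

lemma q_eq_zero_iff {s : ℕ} {i j : Fin n} (h : P.E (s + 1) i j) :
    P.q (s + 1) i j = 0 ↔ |P.err s i j| ≤ 1 / ((s + 1 : ℕ) : ℝ) ^ P.α := by
  rw [P.hq _ (by omega) i j h, Nat.add_sub_cancel]
  exact Rq_mul_eq_zero_iff (succ_rpow_pos s P.α)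

/-- Stated for `σ = ±1`, so that it covers the upper and the lower bound at once. -/
lemma sum_update_le {s : ℕ} {b σ : ℝ} (hσ : σ = 1 ∨ σ = -1) (hb : ∀ k, σ * P.x s k ≤ b)
    (i : Fin n) :
    σ * ∑ j ∈ P.S (s + 1) i, (P.xin (s + 1) i j - P.xout (s + 1) i j) / (4 * P.D i j (s + 1))
      ≤ (b - σ * P.x s i) / 2 := by
  have hbi : 0 ≤ b - σ * P.x s i := by linarith [hb i]
  rcases (P.S (s + 1) i).eq_empty_or_nonempty with h0 | h0
  · rw [h0]; simp; linarith
  have hc : (0 : ℝ) < (P.S (s + 1) i).card := by exact_mod_cast h0.card_pos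
  have hterm : ∀ j ∈ P.S (s + 1) i,
      σ * ((P.xin (s + 1) i j - P.xout (s + 1) i j) / (4 * P.D i j (s + 1))) ≤
        (b - σ * P.x s i) / 2 / (P.S (s + 1) i).card := by
    intro j hj
    have hj' := hj
    simp only [S, Finset.mem_filter, Finset.mem_univ, true_and] at hj'
    obtain ⟨hE, hgap, hqj, hqi⟩ := hj'
    have hD : ((P.S (s + 1) i).card : ℝ) ≤ P.D i j (s + 1) := by
      refine le_trans ?_ (P.Dbound _ i j hE)
      rw [Nat.cast_le]
      refine le_trans ?_ (le_max_left _ _)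
      rw [← Set.ncard_coe_finset]
      refine Set.ncard_le_ncard (fun k hk => ?_) (Set.toFinite _)
      simp only [S, Finset.coe_filter, Finset.mem_univ, true_and, Set.mem_ofPred_eq] at hk
      exact hk.1
    have hin : P.xin (s + 1) i j = P.xout s j i := by
      rw [P.hxinE _ (by omega) i j hE, hqj, Nat.add_sub_cancel, P.xin_eq_xout]; simp
    have hout : P.xout (s + 1) i j = P.xout s i j := by
      rw [P.hxoutE _ (by omega) i j hE, hqi, Nat.add_sub_cancel]; simp
    have hei := (P.q_eq_zero_iff hE).1 hqi
    have hej := (P.q_eq_zero_iff (P.Esymm _ _ _ hE)).1 hqj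
    rw [hin, hout] at hgap ⊢
    have hbj := hb j
    have hy : σ * (P.xout s j i - P.xout s i j) ≤ 2 * (b - σ * P.x s i) := by
      have h4 : 4 / ((s + 1 : ℕ) : ℝ) ^ P.α = 4 * (1 / ((s + 1 : ℕ) : ℝ) ^ P.α) := by ring
      rw [h4] at hgap
      unfold err at hei hej
      rw [abs_le] at hei hej
      generalize 1 / ((s + 1 : ℕ) : ℝ) ^ P.α = g at *
      rcases hσ with rfl | rfl <;> rcases lt_abs.1 hgap with h | h <;> linarith
    have hD0 : 0 < P.D i j (s + 1) := hc.trans_le hD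
    calc σ * ((P.xout s j i - P.xout s i j) / (4 * P.D i j (s + 1)))
        = σ * (P.xout s j i - P.xout s i j) / (4 * P.D i j (s + 1)) := by ring
      _ ≤ 2 * (b - σ * P.x s i) / (4 * P.D i j (s + 1)) := by gcongr
      _ = (b - σ * P.x s i) / 2 / P.D i j (s + 1) := by field_simp; ring
      _ ≤ (b - σ * P.x s i) / 2 / (P.S (s + 1) i).card := by gcongr
  rw [Finset.mul_sum]
  refine (Finset.sum_le_sum hterm).trans ?_
  rw [Finset.sum_const, nsmul_eq_mul, mul_div_cancel₀ _ hc.ne']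

lemma x_succ (s : ℕ) (i : Fin n) : P.x (s + 1) i = P.x s i + (1 / ((s + 1 : ℕ) : ℝ) ^ P.β) *
    ∑ j ∈ P.S (s + 1) i, (P.xin (s + 1) i j - P.xout (s + 1) i j) / (4 * P.D i j (s + 1)) := by
  have h := P.hx (s + 1) (by omega) i
  rw [Nat.add_sub_cancel] at h
  exact h

lemma x_le {b σ : ℝ} (hσ : σ = 1 ∨ σ = -1) (hb : ∀ k, σ * P.x 0 k ≤ b) (s : ℕ) (i : Fin n) :
    σ * P.x s i ≤ b := by
  induction s generalizing i with
  | zero => exact hb i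
  | succ s ih =>
    have h := P.sum_update_le hσ ih i
    have hp : 0 ≤ 1 / ((s + 1 : ℕ) : ℝ) ^ P.β := (one_div_pos.2 (succ_rpow_pos s _)).le
    have h1 : 1 / ((s + 1 : ℕ) : ℝ) ^ P.β ≤ 1 := by
      rw [div_le_one (succ_rpow_pos s _)]
      refine Real.one_le_rpow (by push_cast; linarith [Nat.cast_nonneg (α := ℝ) s]) ?_
      linarith [P.hα, P.hαβ]
    rw [x_succ, mul_add, mul_left_comm]
    have h2 := mul_le_mul_of_nonneg_left h hp
    nlinarith [ih i]

lemma abs_x_sub_le {a b : ℝ} (ha : ∀ k, a ≤ P.x 0 k) (hb : ∀ k, P.x 0 k ≤ b) (s : ℕ)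
    (i : Fin n) :
    |P.x (s + 1) i - P.x s i| ≤ 1 / ((s + 1 : ℕ) : ℝ) ^ P.β * ((b - a) / 2) := by
  have hp : 0 ≤ 1 / ((s + 1 : ℕ) : ℝ) ^ P.β := (one_div_pos.2 (succ_rpow_pos s _)).le
  have hb' := P.x_le (σ := 1) (b := b) (Or.inl rfl) (by simpa using hb) s
  have ha' := P.x_le (σ := -1) (b := -a) (Or.inr rfl) (by simpa using ha) s
  have h1 := P.sum_update_le (Or.inl rfl) hb' i
  have h2 := P.sum_update_le (Or.inr rfl) ha' i
  rw [x_succ, add_sub_cancel_left, abs_mul, abs_of_nonneg hp]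
  refine mul_le_mul_of_nonneg_left ?_ hp
  have := hb' i
  have := ha' i
  rw [abs_le]
  constructor <;> linarith

lemma abs_x_le {X : ℝ} (hX : ∀ k, |P.x 0 k| ≤ X) (s : ℕ) (i : Fin n) : |P.x s i| ≤ X := by
  have h1 := P.x_le (σ := 1) (b := X) (Or.inl rfl)
    (fun k => by linarith [(abs_le.1 (hX k)).2]) s i
  have h2 := P.x_le (σ := -1) (b := X) (Or.inr rfl)
    (fun k => by linarith [(abs_le.1 (hX k)).1]) s i
  rw [abs_le]
  constructor <;> linarith

lemma abs_xout_le {X : ℝ} (hX : ∀ k, |P.x 0 k| ≤ X) (s : ℕ) (i j : Fin n) :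
    |P.xout s i j| ≤ X := by
  induction s with
  | zero => rw [P.hxout0, abs_zero]; exact (abs_nonneg _).trans (hX i)
  | succ s ih =>
    by_cases hE : P.E (s + 1) i j
    · have hx := abs_le.1 (P.abs_x_le hX s i)
      have hc := succ_rpow_pos s P.α
      have hc' := one_div_pos.2 hc
      rw [P.hxoutE _ (by omega) i j hE, P.hq _ (by omega) i j hE, Nat.add_sub_cancel]
      rw [abs_le] at ih ⊢
      unfold Rq
      split_ifs with h1 h2
      · have h1' := (div_lt_iff₀' hc).2 h1
        constructor <;> linarith
      · have h2' := (lt_div_iff₀' hc).2 h2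
        rw [neg_div] at h2' ⊢
        constructor <;> linarith
      · simpa using ih
    · rw [P.hxoutN _ (by omega) i j hE]; exact ih

lemma abs_err_le {X : ℝ} (hX : ∀ k, |P.x 0 k| ≤ X) (s : ℕ) (i j : Fin n) :
    |P.err s i j| ≤ 2 * X := by
  have := abs_sub (P.x s i) (P.xout s i j)
  unfold err
  linarith [P.abs_x_le hX s i, P.abs_xout_le hX s i j]

lemma abs_err_succ_le_of_q_ne_zero {s : ℕ} {i j : Fin n} {δ : ℝ}
    (hd : |P.x (s + 1) i - P.x s i| ≤ δ) (hE : P.E (s + 1) i j) (hq : P.q (s + 1) i j ≠ 0) :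
    |P.err (s + 1) i j| ≤ |P.err s i j| - 1 / ((s + 1 : ℕ) : ℝ) ^ P.α + δ := by
  rw [Ne, P.q_eq_zero_iff hE, not_le] at hq
  rw [← abs_sub_Rq_div (succ_rpow_pos s P.α) hq]
  have h : P.err (s + 1) i j = (P.err s i j - Rq (((s + 1 : ℕ) : ℝ) ^ P.α * P.err s i j) /
      ((s + 1 : ℕ) : ℝ) ^ P.α) + (P.x (s + 1) i - P.x s i) := by
    unfold err
    rw [P.hxoutE _ (by omega) i j hE, P.hq _ (by omega) i j hE, Nat.add_sub_cancel]
    ring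
  rw [h]
  exact (abs_add_le _ _).trans (by linarith)

lemma err_succ_of_xout_eq {s : ℕ} {i j : Fin n} {δ : ℝ}
    (hd : |P.x (s + 1) i - P.x s i| ≤ δ) (h : P.xout (s + 1) i j = P.xout s i j) :
    |P.err (s + 1) i j| ≤ |P.err s i j| + δ := by
  have h : P.err (s + 1) i j = P.err s i j + (P.x (s + 1) i - P.x s i) := by
    unfold err; rw [h]; ring
  rw [h]
  exact (abs_add_le _ _).trans (by linarith)

lemma xout_succ_of_q_eq_zero {s : ℕ} {i j : Fin n} (hE : P.E (s + 1) i j)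
    (hq : P.q (s + 1) i j = 0) : P.xout (s + 1) i j = P.xout s i j := by
  rw [P.hxoutE _ (by omega) i j hE, hq, Nat.add_sub_cancel]; simp

lemma abs_err_succ_le {s : ℕ} {i j : Fin n} {δ : ℝ} (hd : |P.x (s + 1) i - P.x s i| ≤ δ) :
    |P.err (s + 1) i j| ≤ |P.err s i j| + δ := by
  by_cases hE : P.E (s + 1) i j
  · by_cases hq : P.q (s + 1) i j = 0
    · exact P.err_succ_of_xout_eq hd (P.xout_succ_of_q_eq_zero hE hq)
    · have := P.abs_err_succ_le_of_q_ne_zero hd hE hq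
      have := one_div_pos.2 (succ_rpow_pos s P.α)
      linarith
  · exact P.err_succ_of_xout_eq hd (P.hxoutN _ (by omega) i j hE)

lemma abs_err_succ_le_max {s : ℕ} {i j : Fin n} {δ : ℝ} (hd : |P.x (s + 1) i - P.x s i| ≤ δ)
    (hE : P.E (s + 1) i j) :
    |P.err (s + 1) i j| ≤ max (|P.err s i j| - 1 / ((s + 1 : ℕ) : ℝ) ^ P.α)
      (1 / ((s + 1 : ℕ) : ℝ) ^ P.α) + δ := by
  by_cases hq : P.q (s + 1) i j = 0
  · refine (P.err_succ_of_xout_eq hd (P.xout_succ_of_q_eq_zero hE hq)).trans ?_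
    have := (P.q_eq_zero_iff hE).1 hq
    linarith [le_max_right (|P.err s i j| - 1 / ((s + 1 : ℕ) : ℝ) ^ P.α)
      (1 / ((s + 1 : ℕ) : ℝ) ^ P.α)]
  · refine (P.abs_err_succ_le_of_q_ne_zero hd hE hq).trans ?_
    linarith [le_max_left (|P.err s i j| - 1 / ((s + 1 : ℕ) : ℝ) ^ P.α)
      (1 / ((s + 1 : ℕ) : ℝ) ^ P.α)]

lemma abs_err_le_add_mul {s u : ℕ} (hsu : s ≤ u) {i j : Fin n} {δ : ℝ}
    (hd : ∀ v, s ≤ v → |P.x (v + 1) i - P.x v i| ≤ δ) :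
    |P.err u i j| ≤ |P.err s i j| + ((u : ℝ) - s) * δ := by
  induction u, hsu using Nat.le_induction with
  | base => simp
  | succ u hu ih =>
    have := P.abs_err_succ_le (j := j) (hd u hu)
    push_cast
    linarith

/-- The drift of `x_i` from time `s` on, when it is slow compared to the quantization step. -/
lemma drift_le {B T : ℝ} (hB : 0 < B) (hT : 0 < T) {i : Fin n}
    (hd : ∀ s : ℕ, T ≤ s →
      |P.x (s + 1) i - P.x s i| ≤ 1 / ((s + 1 : ℕ) : ℝ) ^ P.α / (16 * B))
    {s : ℕ} (hs : T ≤ s) (v : ℕ) (hv : s ≤ v) :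
    |P.x (v + 1) i - P.x v i| ≤ 1 / (s : ℝ) ^ P.α / (16 * B) := by
  have hsv : (s : ℝ) ≤ v := by exact_mod_cast hv
  refine (hd v (hs.trans hsv)).trans ?_
  gcongr ?_ / _
  exact one_div_rpow_anti P.hα.le (hT.trans_le hs) (by push_cast; linarith)

/-- During a window containing the edge, the error decreases by half a step or is small. -/
lemma abs_err_window {B : ℕ} (hB : 0 < B) {T : ℝ} (hT : 32 * (B : ℝ) ≤ T) {i j : Fin n}
    (hd : ∀ s : ℕ, T ≤ s →
      |P.x (s + 1) i - P.x s i| ≤ 1 / ((s + 1 : ℕ) : ℝ) ^ P.α / (16 * B))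
    {s : ℕ} (hs : T ≤ s) (he : ∃ u, s ≤ u ∧ u < s + B ∧ P.E (u + 1) i j) :
    |P.err (s + B) i j| ≤ max (|P.err s i j| - 1 / ((s + B : ℕ) : ℝ) ^ P.α / 2)
      (9 / 8 * (1 / ((s + B : ℕ) : ℝ) ^ P.α)) ∧
    1 / (s : ℝ) ^ P.α ≤ 33 / 32 * (1 / ((s + B : ℕ) : ℝ) ^ P.α) := by
  obtain ⟨u, hsu, hub, hE⟩ := he
  have hB' : (0 : ℝ) < B := by exact_mod_cast hB
  have hT0 : 0 < T := by linarith
  have hs0 : (0 : ℝ) < s := by linarith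
  have hδ := P.drift_le hB' hT0 hd hs
  have h1 := P.abs_err_le_add_mul (j := j) hsu hδ
  have h2 := P.abs_err_succ_le_max (hδ u hsu) hE
  have h3 := P.abs_err_le_add_mul (j := j) (s := u + 1) (u := s + B) (by omega)
    (fun v hv => hδ v (by omega))
  have hg1 : 1 / ((u + 1 : ℕ) : ℝ) ^ P.α ≤ 1 / (s : ℝ) ^ P.α :=
    one_div_rpow_anti P.hα.le hs0 (by exact_mod_cast (by omega : s ≤ u + 1))
  have hg2 : 1 / ((s + B : ℕ) : ℝ) ^ P.α ≤ 1 / ((u + 1 : ℕ) : ℝ) ^ P.α :=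
    one_div_rpow_anti P.hα.le (by positivity) (by exact_mod_cast (by omega : u + 1 ≤ s + B))
  have hm := mul_one_div_rpow_mono (a := P.α) (by linarith [P.hαβ, P.hβ]) hs0
    (u := ((s + B : ℕ) : ℝ)) (by push_cast; linarith)
  have hρ : 0 < 1 / ((s + B : ℕ) : ℝ) ^ P.α :=
    one_div_pos.2 (Real.rpow_pos_of_pos (by positivity) _)
  generalize 1 / ((s + B : ℕ) : ℝ) ^ P.α = ρ at *
  generalize 1 / ((u + 1 : ℕ) : ℝ) ^ P.α = g at *
  generalize 1 / (s : ℝ) ^ P.α = g₀ at *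
  have hg0 : g₀ ≤ 33 / 32 * ρ := by
    push_cast at hm
    have : ((s : ℝ) + B) * ρ ≤ s * (33 / 32 * ρ) := by nlinarith
    exact le_of_mul_le_mul_left (hm.trans this) hs0
  refine ⟨?_, hg0⟩
  have hBδ : (B : ℝ) * (g₀ / (16 * B)) = g₀ / 16 := by field_simp
  have hδ0 : 0 ≤ g₀ / (16 * B) := (abs_nonneg _).trans (hδ u hsu)
  have hu : (0 : ℝ) ≤ (u : ℝ) - s := by simpa using hsu
  generalize g₀ / (16 * (B : ℝ)) = δ at *
  push_cast at h3
  have hnn : 0 ≤ ((u : ℝ) - s) * δ := mul_nonneg hu hδ0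
  rcases max_choice (|P.err u i j| - g) g with h | h <;> rw [h] at h2
  · exact le_max_of_le_left (by linarith)
  · exact le_max_of_le_right (by linarith)

lemma abs_err_le_of_late {B : ℕ} (hB : 0 < B) {T X : ℝ} (hT : 32 * (B : ℝ) ≤ T) {i j : Fin n}
    (hd : ∀ s : ℕ, T ≤ s →
      |P.x (s + 1) i - P.x s i| ≤ 1 / ((s + 1 : ℕ) : ℝ) ^ P.α / (16 * B))
    (he : ∀ k : ℕ, ∃ u, k * B ≤ u ∧ u < k * B + B ∧ P.E (u + 1) i j)
    (hX : ∀ s, |P.err s i j| ≤ 2 * X) {k : ℕ} (hk : 4 * T ≤ (k * B : ℕ))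
    (hkX : 8 * B * X ≤ (k * B : ℕ) * (1 / ((k * B : ℕ) : ℝ) ^ P.α)) :
    |P.err (k * B) i j| ≤ 9 / 8 * (1 / ((k * B : ℕ) : ℝ) ^ P.α) := by
  have hB' : (0 : ℝ) < B := by exact_mod_cast hB
  have hk' : (128 : ℝ) ≤ k := by
    push_cast at hk
    exact le_of_mul_le_mul_right (by linarith) hB'
  have hkn : 128 ≤ k := by exact_mod_cast hk'
  set τ := 1 / ((k * B : ℕ) : ℝ) ^ P.α with hτ
  have hτ0 : 0 < τ := one_div_pos.2 (Real.rpow_pos_of_pos (by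
    have : 0 < k := by omega
    positivity) _)
  have hlate : ∀ m, k / 2 ≤ m → T ≤ (m * B : ℕ) := by
    intro m hm
    have : (k : ℝ) ≤ 4 * m := by exact_mod_cast (by omega : k ≤ 4 * m)
    push_cast at hk ⊢
    nlinarith
  have key : ∀ m, k / 2 ≤ m → m ≤ k → |P.err (m * B) i j| ≤
      max (2 * X - ((m : ℝ) - (k / 2 : ℕ)) * (τ / 2)) (9 / 8 * (1 / ((m * B : ℕ) : ℝ) ^ P.α)) := by
    intro m hm
    induction m, hm using Nat.le_induction with
    | base => intro _; exact le_max_of_le_left (by simpa using hX _)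
    | succ m hm ih =>
      intro hmk
      obtain ⟨h1, h2⟩ := P.abs_err_window hB hT hd (hlate m hm) (he m)
      have hadd : (m + 1) * B = m * B + B := by ring
      have hτ' : τ ≤ 1 / ((m * B + B : ℕ) : ℝ) ^ P.α := by
        refine one_div_rpow_anti P.hα.le (by positivity) ?_
        rw [← hadd]
        exact_mod_cast Nat.mul_le_mul_right B hmk
      rw [hadd]
      have ih' := ih (by omega)
      push_cast at h1 h2 hτ' ih' ⊢
      rcases le_max_iff.1 h1 with h | h
      · rcases le_max_iff.1 ih' with h' | h'
        · exact le_max_of_le_left (by linarith)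
        · exact le_max_of_le_right (by linarith)
      · exact le_max_of_le_right h
  rcases le_max_iff.1 (key k (by omega) le_rfl) with h | h
  · have h2 : ((k / 2 : ℕ) : ℝ) ≤ k / 2 := Nat.cast_div_le
    have h3 : 8 * X ≤ k * τ := by
      push_cast at hkX
      exact le_of_mul_le_mul_left (by push_cast at hτ ⊢; linarith) hB'
    nlinarith
  · exact h

/-- In three late windows, at most one of the messages across a directed edge is nonzero. -/
lemma q_eq_zero_of_q_ne_zero {B : ℕ} (hB : 0 < B) {i j : Fin n} {t : ℕ} (ht : 128 * B ≤ t)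
    (hd : ∀ v, t ≤ v → |P.x (v + 1) i - P.x v i| ≤ 1 / (t : ℝ) ^ P.α / (16 * B))
    (herr : |P.err t i j| ≤ 9 / 8 * (1 / (t : ℝ) ^ P.α)) {u w : ℕ} (htu : t ≤ u) (huw : u < w)
    (hwt : w < t + 3 * B) (hE : P.E (u + 1) i j) (hE' : P.E (w + 1) i j)
    (hq : P.q (u + 1) i j ≠ 0) : P.q (w + 1) i j = 0 := by
  rw [P.q_eq_zero_iff hE']
  have hB' : (0 : ℝ) < B := by exact_mod_cast hB
  have ht' : 128 * (B : ℝ) ≤ t := by exact_mod_cast ht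
  have ht0 : (0 : ℝ) < t := by linarith
  have h1 := P.abs_err_le_add_mul (j := j) htu hd
  have h2 := P.abs_err_succ_le_of_q_ne_zero (hd u htu) hE hq
  have h3 := P.abs_err_le_add_mul (j := j) (s := u + 1) (u := w) (by omega)
    (fun v hv => hd v (by omega))
  have hlow : ∀ v, t ≤ v → v < t + 3 * B →
      128 / 131 * (1 / (t : ℝ) ^ P.α) ≤ 1 / ((v + 1 : ℕ) : ℝ) ^ P.α := by
    intro v hv hv'
    have hv1 : ((v + 1 : ℕ) : ℝ) ≤ 131 / 128 * t := by
      have : ((v + 1 : ℕ) : ℝ) ≤ t + 3 * B := by exact_mod_cast hv'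
      linarith
    have hm := mul_one_div_rpow_mono (a := P.α) (by linarith [P.hαβ, P.hβ]) ht0
      (u := ((v + 1 : ℕ) : ℝ)) (by exact_mod_cast (by omega : t ≤ v + 1))
    have hp := one_div_pos.2 (succ_rpow_pos v P.α)
    have : (t : ℝ) * (1 / (t : ℝ) ^ P.α) ≤ t * (131 / 128 * (1 / ((v + 1 : ℕ) : ℝ) ^ P.α)) := by
      nlinarith
    linarith [le_of_mul_le_mul_left this ht0]
  have hu := hlow u htu (by omega)
  have hw := hlow w (by omega) hwt
  have hτ0 : 0 < 1 / (t : ℝ) ^ P.α := one_div_pos.2 (Real.rpow_pos_of_pos ht0 _)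
  have hδ0 : 0 ≤ 1 / (t : ℝ) ^ P.α / (16 * B) := (abs_nonneg _).trans (hd u htu)
  have hsum : ((w : ℝ) - t) * (1 / (t : ℝ) ^ P.α / (16 * B)) ≤ 3 / 16 * (1 / (t : ℝ) ^ P.α) := by
    calc ((w : ℝ) - t) * (1 / (t : ℝ) ^ P.α / (16 * B))
        ≤ (3 * B) * (1 / (t : ℝ) ^ P.α / (16 * B)) := by
          refine mul_le_mul_of_nonneg_right ?_ hδ0
          have : (w : ℝ) ≤ t + 3 * B := by exact_mod_cast hwt.le
          linarith
      _ = _ := by field_simp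
  push_cast at h3
  linarith

/-- The consequences of the lower bound on `t` that the proof uses. -/
lemma late_bounds {a b W X t : ℝ} {B : ℕ} (hB : 0 < B) (ha : 0 < a) (hab : a < b) (hb : b < 1)
    (hW : 0 ≤ W) (hX : 0 ≤ X)
    (ht : (2 : ℝ) ^ ((2 : ℝ) / (1 - a)) *
      ((⌈32 * (B : ℝ) + 8 * B * W⌉ : ℝ)) ^ ((1 : ℝ) / (b - a)) +
      (32 * B * X) ^ ((2 : ℝ) / (1 - a)) ≤ t) :
    ∃ T : ℝ, 32 * (B : ℝ) ≤ T ∧ 4 * T ≤ t ∧ 8 * B * X ≤ t * (1 / t ^ a) ∧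
      ∀ s, T ≤ s → 1 / s ^ b * (W / 2) ≤ 1 / s ^ a / (16 * B) := by
  have hB1 : (1 : ℝ) ≤ B := by exact_mod_cast hB
  set K : ℝ := (⌈32 * (B : ℝ) + 8 * B * W⌉ : ℝ) with hKdef
  have hK : 32 * (B : ℝ) + 8 * B * W ≤ K := Int.le_ceil _
  have hBW : 0 ≤ (B : ℝ) * W := by positivity
  have hK1 : 1 ≤ K := by linarith
  have hKT : K ≤ K ^ ((1 : ℝ) / (b - a)) :=
    Real.self_le_rpow_of_one_le hK1 ((one_le_div (by linarith)).2 (by linarith))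
  have h4 : (4 : ℝ) ≤ (2 : ℝ) ^ ((2 : ℝ) / (1 - a)) := by
    calc (4 : ℝ) = (2 : ℝ) ^ (2 : ℝ) := by norm_num
      _ ≤ _ := Real.rpow_le_rpow_of_exponent_le (by norm_num)
        ((le_div_iff₀ (by linarith)).2 (by linarith))
  have hY : 0 ≤ (32 * B * X) ^ ((2 : ℝ) / (1 - a)) := by positivity
  have hT4 : 4 * K ^ ((1 : ℝ) / (b - a)) ≤
      (2 : ℝ) ^ ((2 : ℝ) / (1 - a)) * K ^ ((1 : ℝ) / (b - a)) :=
    mul_le_mul_of_nonneg_right h4 (by positivity)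
  have ht1 : 1 ≤ t := by linarith
  refine ⟨K ^ ((1 : ℝ) / (b - a)), by linarith, by linarith, ?_, fun s hs => ?_⟩
  · have e : t * (1 / t ^ a) = t ^ (1 - a) := by
      rw [Real.rpow_sub (by linarith), Real.rpow_one, mul_one_div]
    have h1 : 1 ≤ t ^ (1 - a) := Real.one_le_rpow ht1 (by linarith)
    have h2 : (32 * B * X) ^ 2 ≤ t ^ (1 - a) := by
      have : (32 * B * X) ^ ((2 : ℝ) / (1 - a)) ≤ t := by linarith
      calc (32 * B * X) ^ 2 = ((32 * B * X) ^ ((2 : ℝ) / (1 - a))) ^ (1 - a) := by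
            rw [← Real.rpow_mul (by positivity), div_mul_cancel₀ _ (by linarith : (1 - a) ≠ 0),
              Real.rpow_two]
        _ ≤ _ := Real.rpow_le_rpow hY this (by linarith)
    rw [e]
    have : 0 ≤ B * X := by positivity
    nlinarith [sq_nonneg (32 * B * X - 1)]
  · have hs0 : 0 < s := by linarith
    have hKs : K ≤ s ^ (b - a) := by
      calc K = (K ^ ((1 : ℝ) / (b - a))) ^ (b - a) := by
            rw [← Real.rpow_mul (by linarith), div_mul_cancel₀ _ (by linarith : (b - a) ≠ 0),
              Real.rpow_one]
        _ ≤ _ := Real.rpow_le_rpow (by positivity) hs (by linarith)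
    have e : s ^ b = s ^ (b - a) * s ^ a := by rw [← Real.rpow_add hs0]; ring_nf
    have hsa := Real.rpow_pos_of_pos hs0 a
    have hsba := Real.rpow_pos_of_pos hs0 (b - a)
    rw [e, div_div, ← one_div_mul_one_div, mul_comm (1 / s ^ (b - a)), mul_assoc,
      ← one_div_mul_one_div]
    refine mul_le_mul_of_nonneg_left ?_ (by positivity)
    rw [one_div_mul_eq_div, div_div, div_le_div_iff₀ (by positivity) (by positivity)]
    nlinarith

end Protocol

/-- on a core edge, in every window `[t+1, t+3B]` after a late enough
multiple `t` of `B`, there is a time at which both messages across the edge are zero. -/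
theorem stmt12_both_messages_zero {n : ℕ} (hn : 1 ≤ n) (P : Protocol n)
    (B : ℕ) (hB : 0 < B) (Einf : Fin n → Fin n → Prop)
    (hcore : P.CoreConnected B Einf) (i j : Fin n) (hij : Einf i j)
    (t : ℕ) (hmul : B ∣ t)
    (ht : (2 : ℝ) ^ ((2 : ℝ) / (1 - P.α)) *
        ((⌈32 * (B : ℝ) + 8 * B * Wsp (P.x 0)⌉ : ℝ)) ^ ((1 : ℝ) / (P.β - P.α)) +
        (32 * B * normInf (P.x 0)) ^ ((2 : ℝ) / (1 - P.α)) ≤ (t : ℝ)) :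
    ∃ t', t + 1 ≤ t' ∧ t' ≤ t + 3 * B ∧ P.E t' i j ∧
      P.q t' i j = 0 ∧ P.q t' j i = 0 := by
  obtain ⟨k, rfl⟩ := hmul
  rw [mul_comm B k] at ht ⊢
  have hB' : (0 : ℝ) < B := by exact_mod_cast hB
  have hfin : (Set.range (P.x 0)).Finite := Set.finite_range _
  have hfin' : (Set.range fun v => |P.x 0 v|).Finite := Set.finite_range _
  have hmax : ∀ v, P.x 0 v ≤ maxV (P.x 0) := le_ciSup hfin.bddAbove
  have hmin : ∀ v, minV (P.x 0) ≤ P.x 0 v := ciInf_le hfin.bddBelow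
  have hX : ∀ v, |P.x 0 v| ≤ normInf (P.x 0) := le_ciSup hfin'.bddAbove
  have hW0 : 0 ≤ Wsp (P.x 0) := sub_nonneg.2 ((hmin i).trans (hmax i))
  obtain ⟨T, hT, hTt, htX, hTd⟩ := Protocol.late_bounds hB P.hα P.hαβ P.hβ hW0
    ((abs_nonneg _).trans (hX i)) ht
  have hd : ∀ v, ∀ s : ℕ, T ≤ s →
      |P.x (s + 1) v - P.x s v| ≤ 1 / ((s + 1 : ℕ) : ℝ) ^ P.α / (16 * B) := fun v s hs =>
    (P.abs_x_sub_le hmin hmax s v).trans (hTd _ (by push_cast; linarith))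
  have he : ∀ k : ℕ, ∃ u, k * B ≤ u ∧ u < k * B + B ∧ P.E (u + 1) i j := by
    intro k
    obtain ⟨u, h1, h2, h3⟩ := hcore.2.2 k i j hij
    rw [add_mul, one_mul] at h2
    refine ⟨u - 1, by omega, by omega, ?_⟩
    rwa [Nat.sub_add_cancel (by omega)]
  have he' : ∀ k : ℕ, ∃ u, k * B ≤ u ∧ u < k * B + B ∧ P.E (u + 1) j i := fun k =>
    (he k).imp fun u hu => ⟨hu.1, hu.2.1, P.Esymm _ _ _ hu.2.2⟩
  have herr := P.abs_err_le_of_late hB hT (hd i) he (fun s => P.abs_err_le hX s i j) hTt htX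
  have herr' := P.abs_err_le_of_late hB hT (hd j) he' (fun s => P.abs_err_le hX s j i) hTt htX
  have ht128 : 128 * B ≤ k * B := by
    have : 128 * (B : ℝ) ≤ (k * B : ℕ) := by linarith
    exact_mod_cast this
  have hdk := fun v => P.drift_le hB' (by linarith) (hd v) (s := k * B) (by linarith)
  obtain ⟨u₁, h1, h1', hE1⟩ := he k
  obtain ⟨u₂, h2, h2', hE2⟩ := he (k + 1)
  obtain ⟨u₃, h3, h3', hE3⟩ := he (k + 2)
  rw [add_mul] at h2 h2' h3 h3'
  have hone : ∀ u w, k * B ≤ u → u < w → w < k * B + 3 * B → P.E (u + 1) i j →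
      P.E (w + 1) i j → (P.q (u + 1) i j = 0 ∨ P.q (w + 1) i j = 0) ∧
        (P.q (u + 1) j i = 0 ∨ P.q (w + 1) j i = 0) := fun u w hu huw hw hEu hEw =>
    ⟨or_iff_not_imp_left.2
        (P.q_eq_zero_of_q_ne_zero hB ht128 (hdk i) herr hu huw hw hEu hEw),
      or_iff_not_imp_left.2
        (P.q_eq_zero_of_q_ne_zero hB ht128 (hdk j) herr' hu huw hw
          (P.Esymm _ _ _ hEu) (P.Esymm _ _ _ hEw))⟩
  have h12 := hone u₁ u₂ h1 (by omega) (by omega) hE1 hE2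
  have h13 := hone u₁ u₃ h1 (by omega) (by omega) hE1 hE3
  have h23 := hone u₂ u₃ (by omega) (by omega) (by omega) hE2 hE3
  by_contra! hcon
  have c1 := hcon (u₁ + 1) (by omega) (by omega) hE1
  have c2 := hcon (u₂ + 1) (by omega) (by omega) hE2
  have c3 := hcon (u₃ + 1) (by omega) (by omega) hE3
  clear * - h12 h13 h23 c1 c2 c3
  grind
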